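/- A CNF formula B over variables Y expresses forgetting all variables but Y from A if and only if for every set of literals S over Y that contains exactly one literal for each variable of Y, S ∪ A is satisfiable exactly when S ∪ B is satisfiable. -/

import Mathlib

abbrev Lit : Type := ℕ × Bool
abbrev Clause : Type := Finset Lit
abbrev Cnf : Type := Finset Clause

def Lit.negate (l : Lit) : Lit := (l.1, !l.2)

def litSat (M : ℕ → Bool) (l : Lit) : Prop := M l.1 = l.2

def clauseSat (M : ℕ → Bool) (c : Clause) : Prop := ∃ l ∈ c, litSat M l

def cnfSat (M : ℕ → Bool) (F : Cnf) : Prop := ∀ c ∈ F, clauseSat M c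

def ClTaut (c : Clause) : Prop := ∃ v : ℕ, (v, true) ∈ c ∧ (v, false) ∈ c

def cnfVars (F : Cnf) : Set ℕ := {v | ∃ c ∈ F, ∃ b, (v, b) ∈ c}

inductive PropForm : Type
  | tru : PropForm
  | fls : PropForm
  | var : ℕ → PropForm
  | neg : PropForm → PropForm
  | conj : PropForm → PropForm → PropForm
  | disj : PropForm → PropForm → PropForm

def PropForm.eval (M : ℕ → Bool) : PropForm → Bool
  | .tru => true
  | .fls => false
  | .var n => M n
  | .neg φ => !(PropForm.eval M φ)
  | .conj φ ψ => PropForm.eval M φ && PropForm.eval M ψ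
  | .disj φ ψ => PropForm.eval M φ || PropForm.eval M ψ

def PropForm.vars : PropForm → Set ℕ
  | .tru => ∅
  | .fls => ∅
  | .var n => {n}
  | .neg φ => PropForm.vars φ
  | .conj φ ψ => PropForm.vars φ ∪ PropForm.vars ψ
  | .disj φ ψ => PropForm.vars φ ∪ PropForm.vars ψ

def entailsForm (A : Cnf) (φ : PropForm) : Prop :=
  ∀ M, cnfSat M A → PropForm.eval M φ = true

/-- `B` expresses forgetting all variables but `Y` from `A`. -/
def ForgetExpr (A : Cnf) (Y : Set ℕ) (B : Cnf) : Prop :=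
  cnfVars B ⊆ Y ∧
    ∀ φ : PropForm, PropForm.vars φ ⊆ Y → (entailsForm A φ ↔ entailsForm B φ)

def litSetSat (M : ℕ → Bool) (S : Set Lit) : Prop := ∀ l ∈ S, litSat M l

theorem PropForm.eval_congr {M N : ℕ → Bool} {φ : PropForm}
    (h : ∀ v ∈ φ.vars, M v = N v) : φ.eval M = φ.eval N := by
  induction φ with
  | tru => rfl
  | fls => rfl
  | var n => exact h n rfl
  | neg φ ih => simp only [PropForm.eval, ih h]
  | conj φ ψ ih₁ ih₂ =>
    simp only [PropForm.eval, ih₁ fun v hv => h v (Or.inl hv), ih₂ fun v hv => h v (Or.inr hv)]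
  | disj φ ψ ih₁ ih₂ =>
    simp only [PropForm.eval, ih₁ fun v hv => h v (Or.inl hv), ih₂ fun v hv => h v (Or.inr hv)]

theorem cnfSat_of_eqOn_cnfVars {M N : ℕ → Bool} {F : Cnf}
    (h : ∀ v ∈ cnfVars F, M v = N v) (hM : cnfSat M F) : cnfSat N F := by
  intro c hc
  obtain ⟨l, hl, hlM⟩ := hM c hc
  exact ⟨l, hl, (h l.1 ⟨c, hc, l.2, hl⟩).symm.trans hlM⟩

theorem finite_cnfVars (F : Cnf) : (cnfVars F).Finite := by
  refine (F.biUnion fun c => c.image Prod.fst).finite_toSet.subset ?_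
  rintro v ⟨c, hc, b, hb⟩
  exact Finset.mem_coe.2 (Finset.mem_biUnion.2 ⟨c, hc, Finset.mem_image.2 ⟨(v, b), hb, rfl⟩⟩)

/-- Over a finite set of variables there is a formula whose models are the assignments
agreeing with `N` on that set. -/
theorem exists_propForm_eval_iff_eqOn (N : ℕ → Bool) {T : Set ℕ} (hT : T.Finite) :
    ∃ φ : PropForm, φ.vars ⊆ T ∧ ∀ M, φ.eval M = true ↔ ∀ v ∈ T, M v = N v := by
  induction T, hT using Set.Finite.induction_on with
  | empty => exact ⟨.tru, fun _ h => h, fun M => by simp [PropForm.eval]⟩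
  | @insert a T _ _ ih =>
    obtain ⟨φ, hv, hφ⟩ := ih
    cases hN : N a with
    | true =>
      refine ⟨.conj (.var a) φ, ?_, fun M => ?_⟩
      · exact Set.union_subset (by simp [PropForm.vars]) (hv.trans (Set.subset_insert _ _))
      · simp [PropForm.eval, hφ, hN]
    | false =>
      refine ⟨.conj (.neg (.var a)) φ, ?_, fun M => ?_⟩
      · exact Set.union_subset (by simp [PropForm.vars]) (hv.trans (Set.subset_insert _ _))
      · simp [PropForm.eval, hφ, hN]

/-- A model of `F` agreeing with `N` on the variables of `F` in `Y` can be changed to agree with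
`N` on all of `Y`. -/
theorem exists_model_eqOn_iff {F : Cnf} {Y T : Set ℕ} (N : ℕ → Bool) (hTY : T ⊆ Y)
    (hFT : cnfVars F ∩ Y ⊆ T) :
    (∃ M, (∀ v ∈ Y, M v = N v) ∧ cnfSat M F) ↔ ∃ M, (∀ v ∈ T, M v = N v) ∧ cnfSat M F := by
  classical
  constructor
  · rintro ⟨M, hM, hF⟩
    exact ⟨M, fun v hv => hM v (hTY hv), hF⟩
  · rintro ⟨M, hM, hF⟩
    refine ⟨fun v => if v ∈ Y then N v else M v, fun v hv => if_pos hv,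
      cnfSat_of_eqOn_cnfVars (fun v hv => ?_) hF⟩
    by_cases hY : v ∈ Y
    · simp [hY, hM v (hFT ⟨hv, hY⟩)]
    · simp [hY]

theorem exists_litSetSat_iff_eqOn {S : Set Lit} {Y : Set ℕ} (hS : ∀ l ∈ S, l.1 ∈ Y)
    (hY : ∀ y ∈ Y, Xor ((y, true) ∈ S) ((y, false) ∈ S)) :
    ∃ N : ℕ → Bool, ∀ M, litSetSat M S ↔ ∀ v ∈ Y, M v = N v := by
  classical
  refine ⟨fun v => decide ((v, true) ∈ S), fun M => ⟨fun h v hv => ?_, fun h l hl => ?_⟩⟩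
  · rcases hY v hv with ⟨h₁, _⟩ | ⟨h₁, h₂⟩
    · simpa [litSat, h₁] using h _ h₁
    · simpa [litSat, h₂] using h _ h₁
  · obtain ⟨v, b⟩ := l
    have hM : M v = decide ((v, true) ∈ S) := h v (hS _ hl)
    change M v = b
    rcases hY v (hS _ hl) with ⟨_, h₂⟩ | ⟨_, h₂⟩ <;> cases b <;> simp_all

theorem entailsForm_of_forall_exists_model_eqOn {A B : Cnf} {Y : Set ℕ} {φ : PropForm}
    (hφ : φ.vars ⊆ Y)
    (h : ∀ N, cnfSat N B → ∃ M, (∀ v ∈ Y, M v = N v) ∧ cnfSat M A)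
    (hA : entailsForm A φ) : entailsForm B φ := by
  intro N hN
  obtain ⟨M, hMN, hM⟩ := h N hN
  rw [← PropForm.eval_congr fun v hv => hMN v (hφ hv)]
  exact hA M hM

theorem entailsForm_neg_iff {F : Cnf} {φ : PropForm} :
    entailsForm F (.neg φ) ↔ ¬ ∃ M, φ.eval M = true ∧ cnfSat M F := by
  simp only [entailsForm, PropForm.eval, Bool.not_eq_true', not_exists, not_and']
  simp

/-- `B` (over variables `Y`) expresses forgetting all variables but `Y` from
`A` iff for every set of literals `S` over `Y` containing exactly one literal
for each variable in `Y`, `S ∪ A` is satisfiable exactly when `S ∪ B` is. -/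
theorem stmt4 (A B : Cnf) (Y : Set ℕ) (hB : cnfVars B ⊆ Y) :
    ForgetExpr A Y B ↔
      ∀ S : Set Lit, (∀ l ∈ S, l.1 ∈ Y) →
        (∀ y ∈ Y, Xor' ((y, true) ∈ S) ((y, false) ∈ S)) →
        ((∃ M, litSetSat M S ∧ cnfSat M A) ↔
         (∃ M, litSetSat M S ∧ cnfSat M B)) := by
  constructor
  · rintro ⟨-, hAB⟩ S hS hSY
    obtain ⟨N, hN⟩ := exists_litSetSat_iff_eqOn hS hSY
    obtain ⟨φ, hφT, hφ⟩ := exists_propForm_eval_iff_eqOn N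
      (((finite_cnfVars A).union (finite_cnfVars B)).inter_of_left Y)
    have key := hAB (.neg φ) (hφT.trans Set.inter_subset_right)
    simp only [entailsForm_neg_iff, not_iff_not, hφ] at key
    simp only [hN]
    rw [exists_model_eqOn_iff N Set.inter_subset_right
        (Set.inter_subset_inter_left Y Set.subset_union_left), key,
      exists_model_eqOn_iff N Set.inter_subset_right
        (Set.inter_subset_inter_left Y Set.subset_union_right)]
  · intro h
    have key (N : ℕ → Bool) : (∃ M, (∀ v ∈ Y, M v = N v) ∧ cnfSat M A) ↔
        ∃ M, (∀ v ∈ Y, M v = N v) ∧ cnfSat M B := by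
      have hN (M : ℕ → Bool) :
          litSetSat M {l | l.1 ∈ Y ∧ N l.1 = l.2} ↔ ∀ v ∈ Y, M v = N v :=
        ⟨fun hM v hv => hM (v, N v) ⟨hv, rfl⟩, fun hM l hl => (hM l.1 hl.1).trans hl.2⟩
      simp only [← hN]
      refine h _ (fun l hl => hl.1) fun y hy => ?_
      change Xor _ _
      cases hNy : N y <;> simp [hy, hNy]
    refine ⟨hB, fun φ hφ => ⟨?_, ?_⟩⟩
    · exact entailsForm_of_forall_exists_model_eqOn hφ fun N hN =>
        (key N).2 ⟨N, fun _ _ => rfl, hN⟩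
    · exact entailsForm_of_forall_exists_model_eqOn hφ fun N hN =>
        (key N).1 ⟨N, fun _ _ => rfl, hN⟩
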